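/- arXiv:1902.03665 — 2 statements merged into one kernel-verified Lean document; each statement's English description precedes it below -/
import Mathlib

section
/- Let A be a commutative ring and a, b ∈ A. Define Φ₁(x₁,x₂,y₁,y₂) := x₁ + y₁ + a·x₁y₁ + b·(x₁y₂ + x₂y₁) + a·x₂y₂ and Φ₂(x₁,x₂,y₁,y₂) := x₂ + y₂ + b·x₁y₁ + a·(x₁y₂ + x₂y₁) + b·x₂y₂. Then Φ = (Φ₁,Φ₂) is a commutative two-dimensional formal group law: Φᵢ(x,y) = xᵢ + yᵢ + higher-order terms, Φᵢ(x,y) = Φᵢ(y,x), and the associativity identity Φ(Φ(x,y),z) = Φ(x,Φ(y,z)) holds componentwise as a polynomial identity in the six variables x₁,x₂,y₁,y₂,z₁,z₂ over A. -/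
/-- First component of the two-dimensional bi-parametric multiplicative law:
`Φ₁(x₁,x₂,y₁,y₂) = x₁ + y₁ + a·x₁y₁ + b·(x₁y₂ + x₂y₁) + a·x₂y₂`. -/
def phi1 {R : Type*} [CommRing R] (a b x₁ x₂ y₁ y₂ : R) : R :=
  x₁ + y₁ + a * x₁ * y₁ + b * (x₁ * y₂ + x₂ * y₁) + a * x₂ * y₂

/-- Second component of the two-dimensional bi-parametric multiplicative law:
`Φ₂(x₁,x₂,y₁,y₂) = x₂ + y₂ + b·x₁y₁ + a·(x₁y₂ + x₂y₁) + b·x₂y₂`. -/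
def phi2 {R : Type*} [CommRing R] (a b x₁ x₂ y₁ y₂ : R) : R :=
  x₂ + y₂ + b * x₁ * y₁ + a * (x₁ * y₂ + x₂ * y₁) + b * x₂ * y₂

/-- A quadratic monomial has no coefficients in total degree less than two. -/
theorem MvPolynomial.coeff_C_mul_X_mul_X_of_degree_lt_two {σ R : Type*} [CommSemiring R]
    (c : R) (i j : σ) {d : σ →₀ ℕ} (hd : (d.sum fun _ k => k) < 2) :
    MvPolynomial.coeff d (MvPolynomial.C c * (MvPolynomial.X i * MvPolynomial.X j)) = 0 := by
  have h : (MvPolynomial.C c * (MvPolynomial.X i * MvPolynomial.X j)).IsHomogeneous (0 + (1 + 1)) :=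
    (MvPolynomial.isHomogeneous_C σ c).mul
      ((MvPolynomial.isHomogeneous_X R i).mul (MvPolynomial.isHomogeneous_X R j))
  exact h.coeff_eq_zero hd.ne

/-- for any commutative ring `A` and `a, b ∈ A`, the pair
`Φ = (Φ₁,Φ₂)` is a commutative two-dimensional formal group law:
`Φᵢ(x,y) = xᵢ + yᵢ + higher-order terms`, `Φᵢ(x,y) = Φᵢ(y,x)`, and the
associativity identity `Φ(Φ(x,y),z) = Φ(x,Φ(y,z))` holds componentwise as a
polynomial identity in the six variables `x₁,x₂,y₁,y₂,z₁,z₂` over `A`. -/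
theorem statement14 {A : Type*} [CommRing A] (a b : A) :
    -- linear part: `Φᵢ(x,y) = xᵢ + yᵢ` modulo terms of total degree ≥ 2
    (∀ d : Fin 4 →₀ ℕ, (d.sum fun _ k => k) < 2 →
      MvPolynomial.coeff d (phi1 (MvPolynomial.C a) (MvPolynomial.C b)
          (MvPolynomial.X 0) (MvPolynomial.X 1) (MvPolynomial.X 2)
          (MvPolynomial.X 3 : MvPolynomial (Fin 4) A))
        = MvPolynomial.coeff d
            (MvPolynomial.X 0 + MvPolynomial.X 2 : MvPolynomial (Fin 4) A)) ∧
    (∀ d : Fin 4 →₀ ℕ, (d.sum fun _ k => k) < 2 →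
      MvPolynomial.coeff d (phi2 (MvPolynomial.C a) (MvPolynomial.C b)
          (MvPolynomial.X 0) (MvPolynomial.X 1) (MvPolynomial.X 2)
          (MvPolynomial.X 3 : MvPolynomial (Fin 4) A))
        = MvPolynomial.coeff d
            (MvPolynomial.X 1 + MvPolynomial.X 3 : MvPolynomial (Fin 4) A)) ∧
    -- commutativity `Φᵢ(x,y) = Φᵢ(y,x)`
    (phi1 (MvPolynomial.C a) (MvPolynomial.C b)
        (MvPolynomial.X 0) (MvPolynomial.X 1) (MvPolynomial.X 2)
        (MvPolynomial.X 3 : MvPolynomial (Fin 4) A)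
      = phi1 (MvPolynomial.C a) (MvPolynomial.C b)
          (MvPolynomial.X 2) (MvPolynomial.X 3) (MvPolynomial.X 0)
          (MvPolynomial.X 1)) ∧
    (phi2 (MvPolynomial.C a) (MvPolynomial.C b)
        (MvPolynomial.X 0) (MvPolynomial.X 1) (MvPolynomial.X 2)
        (MvPolynomial.X 3 : MvPolynomial (Fin 4) A)
      = phi2 (MvPolynomial.C a) (MvPolynomial.C b)
          (MvPolynomial.X 2) (MvPolynomial.X 3) (MvPolynomial.X 0)
          (MvPolynomial.X 1)) ∧
    -- associativity `Φ(Φ(x,y),z) = Φ(x,Φ(y,z))`, in the six variables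
    -- `x₁ = X 0, x₂ = X 1, y₁ = X 2, y₂ = X 3, z₁ = X 4, z₂ = X 5`
    (let a' : MvPolynomial (Fin 6) A := MvPolynomial.C a
     let b' : MvPolynomial (Fin 6) A := MvPolynomial.C b
     let u₁ := phi1 a' b' (MvPolynomial.X 0) (MvPolynomial.X 1)
       (MvPolynomial.X 2) (MvPolynomial.X 3)
     let u₂ := phi2 a' b' (MvPolynomial.X 0) (MvPolynomial.X 1)
       (MvPolynomial.X 2) (MvPolynomial.X 3)
     let v₁ := phi1 a' b' (MvPolynomial.X 2) (MvPolynomial.X 3)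
       (MvPolynomial.X 4) (MvPolynomial.X 5)
     let v₂ := phi2 a' b' (MvPolynomial.X 2) (MvPolynomial.X 3)
       (MvPolynomial.X 4) (MvPolynomial.X 5)
     phi1 a' b' u₁ u₂ (MvPolynomial.X 4) (MvPolynomial.X 5)
         = phi1 a' b' (MvPolynomial.X 0) (MvPolynomial.X 1) v₁ v₂ ∧
     phi2 a' b' u₁ u₂ (MvPolynomial.X 4) (MvPolynomial.X 5)
         = phi2 a' b' (MvPolynomial.X 0) (MvPolynomial.X 1) v₁ v₂) := by
  refine ⟨fun d hd => ?_, fun d hd => ?_, ?_, ?_, ?_, ?_⟩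
  · simp only [phi1, mul_add, mul_assoc, MvPolynomial.coeff_add,
      MvPolynomial.coeff_C_mul_X_mul_X_of_degree_lt_two _ _ _ hd, add_zero]
  · simp only [phi2, mul_add, mul_assoc, MvPolynomial.coeff_add,
      MvPolynomial.coeff_C_mul_X_mul_X_of_degree_lt_two _ _ _ hd, add_zero]
  all_goals
    simp only [phi1, phi2]
    ring
end

section
/- Let a, b ∈ ℝ with a + b ≠ 0 and a − b ≠ 0. Define F : ℝ² → ℝ² by F₁(t₁,t₂) = (e^{2(a+b)(t₁+t₂)} − 1)/(2(a+b)) + (e^{2(a−b)(t₁−t₂)} − 1)/(2(a−b)) and F₂(t₁,t₂) = (e^{2(a+b)(t₁+t₂)} − 1)/(2(a+b)) − (e^{2(a−b)(t₁−t₂)} − 1)/(2(a−b)), and define Φ₁(x₁,x₂,y₁,y₂) = x₁ + y₁ + a·x₁y₁ + b·(x₁y₂ + x₂y₁) + a·x₂y₂ and Φ₂(x₁,x₂,y₁,y₂) = x₂ + y₂ + b·x₁y₁ + a·(x₁y₂ + x₂y₁) + b·x₂y₂. Then for all s, t ∈ ℝ²: Φ(F(s), F(t)) = F(s + t), i.e.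 F is a group exponential for the two-dimensional bi-parametric multiplicative formal group law Φ. -/
/-- The map `x ↦ (exp (c x) - 1) / c` is a group exponential for the one-dimensional
multiplicative formal group law `x + y + c x y`. -/
theorem exp_mul_add_sub_one_div {c : ℝ} (hc : c ≠ 0) (x y : ℝ) :
    (Real.exp (c * (x + y)) - 1) / c =
      (Real.exp (c * x) - 1) / c + (Real.exp (c * y) - 1) / c
        + c * ((Real.exp (c * x) - 1) / c) * ((Real.exp (c * y) - 1) / c) := by
  rw [mul_add, Real.exp_add]
  field_simp
  ring


/-- for `a, b ∈ ℝ` with `a + b ≠ 0` and `a − b ≠ 0`, the map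
`F : ℝ² → ℝ²` given by the indicated combinations of exponentials is a group
exponential for the two-dimensional bi-parametric multiplicative formal group
law `Φ`: for all `s, t ∈ ℝ²`, `Φ(F(s),F(t)) = F(s+t)`. -/
theorem statement15 (a b : ℝ) (h1 : a + b ≠ 0) (h2 : a - b ≠ 0) (s t : ℝ × ℝ) :
    let F : ℝ × ℝ → ℝ × ℝ := fun p =>
      ((Real.exp (2 * (a + b) * (p.1 + p.2)) - 1) / (2 * (a + b))
         + (Real.exp (2 * (a - b) * (p.1 - p.2)) - 1) / (2 * (a - b)),
       (Real.exp (2 * (a + b) * (p.1 + p.2)) - 1) / (2 * (a + b))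
         - (Real.exp (2 * (a - b) * (p.1 - p.2)) - 1) / (2 * (a - b)))
    let Φ : ℝ × ℝ → ℝ × ℝ → ℝ × ℝ := fun x y =>
      (x.1 + y.1 + a * x.1 * y.1 + b * (x.1 * y.2 + x.2 * y.1) + a * x.2 * y.2,
       x.2 + y.2 + b * x.1 * y.1 + a * (x.1 * y.2 + x.2 * y.1) + b * x.2 * y.2)
    Φ (F s) (F t) = F (s + t) := by
  intro F Φ
  have hadd := exp_mul_add_sub_one_div (mul_ne_zero two_ne_zero h1) (s.1 + s.2) (t.1 + t.2)
  have hsub := exp_mul_add_sub_one_div (mul_ne_zero two_ne_zero h2) (s.1 - s.2) (t.1 - t.2)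
  rw [add_add_add_comm] at hadd
  rw [sub_add_sub_comm] at hsub
  simp only [F, Φ, Prod.fst_add, Prod.snd_add, hadd, hsub]
  ext <;> ring
end
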